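/- Let n > k ≥ 2 be integers with n even and k even. Then the domination polynomial of the (k,n)-star has exactly one nonzero real root: there is exactly one real number x ≠ 0 with D(S_{k,n−k}, x) = 0, and this root lies in the open interval (−1, 0). -/

import Mathlib

open Polynomial

/-- `S` is a dominating set of `G`. -/
def IsDomSet {V : Type*} (G : SimpleGraph V) (S : Finset V) : Prop :=
  ∀ v : V, v ∉ S → ∃ u ∈ S, G.Adj u v

/-- The domination number of `G`. -/
noncomputable def domNum {V : Type*} [Fintype V] (G : SimpleGraph V) : ℕ :=
  sInf {i : ℕ | ∃ S : Finset V, IsDomSet G S ∧ S.card = i}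

open scoped Classical in
/-- The domination polynomial of `G`, `D(G,x) = Σ_S x^{|S|}` over dominating sets `S`. -/
noncomputable def domPoly {V : Type*} [Fintype V] (G : SimpleGraph V) : Polynomial ℤ :=
  ∑ S ∈ Finset.univ.filter (fun S : Finset V => IsDomSet G S), (X : Polynomial ℤ) ^ S.card

/-- The `(k,n)`-path: vertices `v_1,…,v_n`, distinct `v_i, v_j` adjacent iff `|i-j| ≤ k`. -/
def kPath (k n : ℕ) : SimpleGraph (Fin n) :=
  SimpleGraph.fromRel (fun i j => |(i.val : ℤ) - (j.val : ℤ)| ≤ (k : ℤ))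

/-- The `(k,n)`-cycle: distinct `v_i, v_j` adjacent iff `|i-j| ≤ k` or `{i,j} = {1,n}`. -/
def kCycle (k n : ℕ) : SimpleGraph (Fin n) :=
  SimpleGraph.fromRel (fun i j =>
    |(i.val : ℤ) - (j.val : ℤ)| ≤ (k : ℤ) ∨ |(i.val : ℤ) - (j.val : ℤ)| = (n : ℤ) - 1)

/-- The `(k,n)`-wheel: the `(k,n)`-cycle joined with one extra vertex (the last vertex,
of index `n`) adjacent to all others. -/
def kWheel (k n : ℕ) : SimpleGraph (Fin (n + 1)) :=
  SimpleGraph.fromRel (fun i j =>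
    (i.val < n ∧ j.val < n ∧
      (|(i.val : ℤ) - (j.val : ℤ)| ≤ (k : ℤ) ∨ |(i.val : ℤ) - (j.val : ℤ)| = (n : ℤ) - 1)) ∨
    j.val = n)

/-- The `(k,n)`-star on `n` vertices: `K_k + \bar K_{n-k}`; the first `k` vertices form a
clique, the rest are independent, and every clique vertex is joined to every other vertex. -/
def kStar (k n : ℕ) : SimpleGraph (Fin n) :=
  SimpleGraph.fromRel (fun i _ => i.val < k)

/-- The corona `G ∘ H`. -/
def corona {V W : Type*} (G : SimpleGraph V) (H : SimpleGraph W) :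
    SimpleGraph (V ⊕ V × W) :=
  SimpleGraph.fromRel (fun a b =>
    (∃ u v, a = Sum.inl u ∧ b = Sum.inl v ∧ G.Adj u v) ∨
    (∃ u w w', a = Sum.inr (u, w) ∧ b = Sum.inr (u, w') ∧ H.Adj w w') ∨
    (∃ u w, a = Sum.inl u ∧ b = Sum.inr (u, w)))

/-- The dominating sets of the `(k,n)`-star are the sets meeting the clique, together with the set
of all independent vertices. -/
theorem isDomSet_kStar_iff {k n : ℕ} (hn : k < n) (S : Finset (Fin n)) :
    IsDomSet (kStar k n) S ↔
      ¬ S ⊆ Finset.univ.filter (fun i : Fin n => k ≤ i.val) ∨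
        S = Finset.univ.filter (fun i : Fin n => k ≤ i.val) := by
  constructor
  · intro h
    by_cases hS : S ⊆ Finset.univ.filter (fun i : Fin n => k ≤ i.val)
    · right
      refine Finset.Subset.antisymm hS fun v hv => ?_
      by_contra hvS
      obtain ⟨u, huS, huv⟩ := h v hvS
      have hu := hS huS
      simp only [Finset.mem_filter, Finset.mem_univ, true_and] at hu hv
      simp only [kStar, SimpleGraph.fromRel_adj] at huv
      omega
    · exact Or.inl hS
  · rintro (h | rfl) v hv
    · obtain ⟨u, huS, hu⟩ := Finset.not_subset.mp h
      simp only [Finset.mem_filter, Finset.mem_univ, true_and, not_le] at hu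
      refine ⟨u, huS, ?_⟩
      simp only [kStar, SimpleGraph.fromRel_adj]
      exact ⟨fun e => hv (e ▸ huS), Or.inl hu⟩
    · simp only [Finset.mem_filter, Finset.mem_univ, true_and, not_le] at hv
      refine ⟨⟨k, hn⟩, by simp, ?_⟩
      simp only [kStar, SimpleGraph.fromRel_adj]
      refine ⟨fun e => ?_, Or.inr hv⟩
      rw [← e] at hv
      exact lt_irrefl _ hv

theorem sum_powerset_pow_card {V : Type*} (s : Finset V) (x : ℝ) :
    ∑ t ∈ s.powerset, x ^ t.card = (x + 1) ^ s.card := by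
  simpa using Finset.sum_pow_mul_eq_add_pow x 1 s

theorem card_filter_le_val {k n : ℕ} :
    (Finset.univ.filter (fun i : Fin n => k ≤ i.val)).card = n - k := by
  have h := Finset.card_filter_add_card_filter_not (s := (Finset.univ : Finset (Fin n)))
    (fun i : Fin n => i.val < k)
  simp only [not_lt, Finset.card_univ, Fintype.card_fin, Fin.card_filter_val_lt] at h
  omega

theorem aeval_domPoly_kStar {k n : ℕ} (hn : k < n) (x : ℝ) :
    aeval x (domPoly (kStar k n)) = (x + 1) ^ n - (x + 1) ^ (n - k) + x ^ (n - k) := by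
  classical
  set B := Finset.univ.filter (fun i : Fin n => k ≤ i.val)
  have hfilter : Finset.univ.filter (fun S : Finset (Fin n) => IsDomSet (kStar k n) S) =
      insert B (Finset.univ.powerset \ B.powerset) := by
    ext S
    simp only [Finset.mem_filter, Finset.mem_univ, true_and, isDomSet_kStar_iff hn,
      Finset.mem_insert, Finset.mem_sdiff, Finset.mem_powerset, Finset.subset_univ]
    exact or_comm
  have hsum : aeval x (domPoly (kStar k n)) =
      ∑ S ∈ Finset.univ.filter (fun S : Finset (Fin n) => IsDomSet (kStar k n) S),
        x ^ S.card := by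
    simp only [domPoly, map_sum, map_pow, aeval_X]
  have hsub : B.powerset ⊆ (Finset.univ : Finset (Fin n)).powerset :=
    Finset.powerset_mono.mpr (Finset.subset_univ B)
  have hsdiff := Finset.sum_sdiff (f := fun S : Finset (Fin n) => x ^ S.card) hsub
  rw [sum_powerset_pow_card, sum_powerset_pow_card, card_filter_le_val, Finset.card_univ,
    Fintype.card_fin] at hsdiff
  rw [hsum, hfilter, Finset.sum_insert (by simp), card_filter_le_val]
  linarith

/-- On the unit interval, `t ↦ (1 - t) ^ p - t ^ m * ∑ i < k, t ^ i` is strictly decreasing. -/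
theorem strictAntiOn_one_sub_pow_sub {p m k : ℕ} (hm : m ≠ 0) (hk : 0 < k) :
    StrictAntiOn (fun t : ℝ => (1 - t) ^ p - t ^ m * ∑ i ∈ Finset.range k, t ^ i)
      (Set.Icc 0 1) := by
  intro s hs t ht hst
  have h1 : (1 - t) ^ p ≤ (1 - s) ^ p :=
    pow_le_pow_left₀ (by linarith [ht.2]) (by linarith) p
  have h2 : ∑ i ∈ Finset.range k, s ^ i ≤ ∑ i ∈ Finset.range k, t ^ i :=
    Finset.sum_le_sum fun i _ => pow_le_pow_left₀ hs.1 hst.le i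
  have h3 : s ^ m < t ^ m := pow_lt_pow_left₀ hst hs.1 hm
  have h4 : 0 < ∑ i ∈ Finset.range k, t ^ i :=
    Finset.sum_pos (fun i _ => pow_pos (hs.1.trans_lt hst) i) ⟨0, by simpa using hk⟩
  have h5 : s ^ m * ∑ i ∈ Finset.range k, s ^ i < t ^ m * ∑ i ∈ Finset.range k, t ^ i :=
    (mul_le_mul_of_nonneg_left h2 (pow_nonneg hs.1 m)).trans_lt (mul_lt_mul_of_pos_right h3 h4)
  simp only
  linarith

theorem pow_add_sub_pow_add_pow_factor {k m : ℕ} (hm : m ≠ 0) (heven : Even m) (x : ℝ) :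
    (x + 1) ^ (k + m) - (x + 1) ^ m + x ^ m =
      -x * ((1 - (x + 1)) ^ (m - 1) -
        (x + 1) ^ m * ∑ i ∈ Finset.range k, (x + 1) ^ i) := by
  have h1 : x ^ m = -x * (1 - (x + 1)) ^ (m - 1) := by
    rw [← heven.neg_pow x, ← Nat.succ_pred_eq_of_ne_zero hm, pow_succ']
    simp
  have h2 := geom_sum_mul (x + 1) k
  rw [add_sub_cancel_right] at h2
  rw [h1, pow_add]
  linear_combination -(x + 1) ^ m * h2

theorem pow_add_sub_pow_add_pow_pos {k m : ℕ} (hm : m ≠ 0) (hke : Even k)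
    (hme : Even m) {x : ℝ} (hx : x ≤ -1 ∨ 0 < x) :
    0 < (x + 1) ^ (k + m) - (x + 1) ^ m + x ^ m := by
  rcases hx with hx | hx
  · have h1 : (-(x + 1)) ^ m < (-x) ^ m := pow_lt_pow_left₀ (by linarith) (by linarith) hm
    rw [hme.neg_pow, hme.neg_pow] at h1
    have h2 : 0 ≤ (x + 1) ^ (k + m) := (hke.add hme).pow_nonneg _
    linarith
  · have h1 : (x + 1) ^ m ≤ (x + 1) ^ (k + m) :=
      pow_le_pow_right₀ (by linarith) (by omega)
    have h2 := pow_pos hx m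
    linarith

theorem kStar_exactly_one_nonzero_real_root (k n : ℕ) (hk : 2 ≤ k) (hn : k < n)
    (hneven : Even n) (hkeven : Even k) :
    (∃! x : ℝ, x ≠ 0 ∧ Polynomial.aeval x (domPoly (kStar k n)) = 0) ∧
      ∀ x : ℝ, x ≠ 0 → Polynomial.aeval x (domPoly (kStar k n)) = 0 →
        -1 < x ∧ x < 0 := by
  obtain ⟨m, rfl⟩ := Nat.exists_eq_add_of_le hn.le
  have hme : Even m := (Nat.even_add.mp hneven).mp hkeven
  have hm : m ≠ 0 := by omega
  have hm1 : m - 1 ≠ 0 := by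
    obtain ⟨r, rfl⟩ := hme
    omega
  simp only [aeval_domPoly_kStar hn, Nat.add_sub_cancel_left]
  have hloc : ∀ x : ℝ, x ≠ 0 → (x + 1) ^ (k + m) - (x + 1) ^ m + x ^ m = 0 →
      -1 < x ∧ x < 0 := by
    intro x hx0 hx
    have h := mt (pow_add_sub_pow_add_pow_pos (x := x) hm hkeven hme)
      hx.not_gt
    push Not at h
    exact ⟨h.1, lt_of_le_of_ne h.2 hx0⟩
  refine ⟨?_, hloc⟩
  have hanti := strictAntiOn_one_sub_pow_sub (p := m - 1) hm (show 0 < k by omega)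
  set g := fun t : ℝ => (1 - t) ^ (m - 1) - t ^ m * ∑ i ∈ Finset.range k, t ^ i with hg
  have hfact : ∀ x : ℝ, (x + 1) ^ (k + m) - (x + 1) ^ m + x ^ m = -x * g (x + 1) :=
    pow_add_sub_pow_add_pow_factor hm hme
  have hg0 : g 0 = 1 := by simp [hg, hm]
  have hg1 : g 1 = -k := by simp [hg, hm1]
  have hcont : ContinuousOn g (Set.Icc 0 1) := by
    rw [hg]
    fun_prop
  obtain ⟨t, ht, hgt⟩ := intermediate_value_Icc' zero_le_one hcont
    (show (0 : ℝ) ∈ Set.Icc (g 1) (g 0) by rw [hg0, hg1]; simp)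
  have ht1 : t ≠ 1 := by
    rintro rfl
    rw [hg1, neg_eq_zero, Nat.cast_eq_zero] at hgt
    omega
  refine ⟨t - 1, ⟨sub_ne_zero.mpr ht1, ?_⟩, ?_⟩
  · rw [hfact, sub_add_cancel, hgt, mul_zero]
  · rintro y ⟨hy0, hy⟩
    obtain ⟨hy1, hy2⟩ := hloc y hy0 hy
    rw [hfact] at hy
    have hgy : g (y + 1) = 0 := (mul_eq_zero.mp hy).resolve_left (neg_ne_zero.mpr hy0)
    have := hanti.injOn ⟨by linarith, by linarith⟩ ht (hgy.trans hgt.symm)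
    linarith
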